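/- arXiv:2009.13725 — 5 statements merged into one kernel-verified Lean document; each statement's English description precedes it below -/
import Mathlib

section
/- Let $(\mathcal{F}_t)_{t\ge 1}$ be a filtration on a probability space and let $(V_t)_{t\ge 1}$, $(\alpha_t)_{t\ge 1}$, $(\chi_t)_{t\ge 1}$, $(\eta_t)_{t\ge 1}$ be four nonnegative, integrable, $(\mathcal{F}_t)_{t\ge 1}$-adapted real-valued processes such that $\sum_t \alpha_t < \infty$ and $\sum_t \chi_t < \infty$ almost surely, and such that for every $t \in \mathbb{N}$, $\mathbb{E}[V_{t+1} \mid \mathcal{F}_t] \le V_t(1+\alpha_t) + \chi_t - \eta_t$ almost surely. Then $(V_t)_{t\ge 1}$ converges almost surely to a finite random variable $V_\infty$, and $\sum_t \eta_t < \infty$ almost surely. -/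
open MeasureTheory Filter Topology

/-- A sum stopped before it exceeds the level `k` stays below `k`. -/
lemma sum_range_ite_le {x : ℕ → ℝ} (hx : ∀ n, 0 ≤ x n) {k : ℝ} (hk : 0 ≤ k) (n : ℕ) :
    ∑ s ∈ Finset.range n, (if ∑ i ∈ Finset.range (s + 1), x i ≤ k then x s else 0) ≤ k := by
  induction n with
  | zero => simpa using hk
  | succ n ih =>
    by_cases h : ∑ i ∈ Finset.range (n + 1), x i ≤ k
    · refine (Finset.sum_le_sum fun s _ => ?_).trans h
      split_ifs
      exacts [le_rfl, hx s]
    · rw [Finset.sum_range_succ, if_neg h, add_zero]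
      exact ih

/-- The partial products of `1 + a n` with `a` nonnegative and summable converge, and they are
bounded above. -/
lemma exists_tendsto_prod_one_add {a : ℕ → ℝ} (ha : ∀ n, 0 ≤ a n) (hs : Summable a) :
    (∃ L, Tendsto (fun n => ∏ i ∈ Finset.range n, (1 + a i)) atTop (𝓝 L)) ∧
      ∃ B, ∀ n, ∏ i ∈ Finset.range n, (1 + a i) ≤ B := by
  have hB : ∀ n, ∏ i ∈ Finset.range n, (1 + a i) ≤ Real.exp (∑' i, a i) := fun n => by
    calc ∏ i ∈ Finset.range n, (1 + a i) ≤ ∏ i ∈ Finset.range n, Real.exp (a i) := by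
          refine Finset.prod_le_prod (fun i _ => by linarith [ha i]) fun i _ => ?_
          linarith [Real.add_one_le_exp (a i)]
      _ = Real.exp (∑ i ∈ Finset.range n, a i) := (Real.exp_sum _ _).symm
      _ ≤ _ := Real.exp_le_exp.2 (hs.sum_le_tsum _ fun i _ => ha i)
  have hmono : Monotone fun n => ∏ i ∈ Finset.range n, (1 + a i) :=
    monotone_nat_of_le_succ fun n => by
      rw [Finset.prod_range_succ]
      exact le_mul_of_one_le_right (Finset.prod_nonneg fun i _ => by linarith [ha i])
        (by linarith [ha n])
  exact ⟨⟨_, tendsto_atTop_ciSup hmono ⟨_, Set.forall_mem_range.2 hB⟩⟩, _, hB⟩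

/-- The Robbins–Siegmund theorem without multiplicative perturbation, and with uniformly bounded
additive perturbation. -/
lemma ae_tendsto_and_summable_of_condExp_le_add_sub
    {Ω : Type*} {m0 : MeasurableSpace Ω} {μ : Measure Ω} [IsFiniteMeasure μ]
    (ℱ : Filtration ℕ m0) (V χ η : ℕ → Ω → ℝ)
    (hVad : Adapted ℱ V) (hχad : Adapted ℱ χ) (hηad : Adapted ℱ η)
    (hVnn : ∀ t ω, 0 ≤ V t ω) (hχnn : ∀ t ω, 0 ≤ χ t ω) (hηnn : ∀ t ω, 0 ≤ η t ω)
    (hVint : ∀ t, Integrable (V t) μ) (hχint : ∀ t, Integrable (χ t) μ)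
    (hηint : ∀ t, Integrable (η t) μ) (k : ℝ)
    (hχk : ∀ t ω, ∑ s ∈ Finset.range t, χ s ω ≤ k)
    (hrec : ∀ t : ℕ, μ[V (t + 1) | ℱ t] ≤ᵐ[μ] fun ω => V t ω + χ t ω - η t ω) :
    ∀ᵐ ω ∂μ, (∃ v, Tendsto (fun t => V t ω) atTop (𝓝 v)) ∧ Summable fun t => η t ω := by
  set D : ℕ → Ω → ℝ := fun t => ∑ s ∈ Finset.range t, (χ s - η s) with hD
  set U : ℕ → Ω → ℝ := fun t => V t - D t with hU
  have hDint : ∀ t, Integrable (D t) μ := fun t =>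
    integrable_finsetSum' _ fun s _ => (hχint s).sub (hηint s)
  have hDmeas : ∀ t, StronglyMeasurable[ℱ t] (D (t + 1)) := fun t =>
    Finset.stronglyMeasurable_sum _ fun s hs =>
      (((hχad s).sub (hηad s)).mono (ℱ.mono (Finset.mem_range_succ_iff.1 hs))
        le_rfl).stronglyMeasurable
  have hDmeas' : ∀ t, StronglyMeasurable[ℱ t] (D t) := fun t =>
    Finset.stronglyMeasurable_sum _ fun s hs =>
      (((hχad s).sub (hηad s)).mono (ℱ.mono (Finset.mem_range.1 hs).le)
        le_rfl).stronglyMeasurable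
  have hUint : ∀ t, Integrable (U t) μ := fun t => (hVint t).sub (hDint t)
  have hsuper : Supermartingale U ℱ μ := by
    refine supermartingale_nat (fun t => (hVad t).stronglyMeasurable.sub (hDmeas' t)) hUint
      fun t => ?_
    have h1 : μ[U (t + 1) | ℱ t] =ᵐ[μ] μ[V (t + 1) | ℱ t] - D (t + 1) := by
      refine (condExp_sub (hVint _) (hDint _) _).trans ?_
      rw [condExp_of_stronglyMeasurable (ℱ.le t) (hDmeas t) (hDint _)]
    filter_upwards [h1, hrec t] with ω h1 h2
    rw [h1]
    simp only [hU, hD, Pi.sub_apply, Pi.add_apply, Finset.sum_apply, Finset.sum_range_succ] at h2 ⊢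
    linarith
  have hlow : ∀ t ω, -k ≤ U t ω := fun t ω => by
    have h1 := hχk t ω
    have h2 : 0 ≤ ∑ s ∈ Finset.range t, η s ω := Finset.sum_nonneg fun s _ => hηnn s ω
    simp only [hU, hD, Pi.sub_apply, Finset.sum_apply, Finset.sum_sub_distrib]
    linarith [hVnn t ω]
  have hbdd : ∀ t, eLpNorm ((-U) t) 1 μ ≤
      ((∫ ω, U 0 ω ∂μ + ∫ _, 2 * |k| ∂μ).toNNReal : NNReal) := fun t => by
    have hle : ∫ ω, U t ω ∂μ ≤ ∫ ω, U 0 ω ∂μ := by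
      have := hsuper.setIntegral_le (Nat.zero_le t) MeasurableSet.univ
      simpa using this
    have hn : ∫ ω, ‖(-U) t ω‖ ∂μ ≤ ∫ ω, U 0 ω ∂μ + ∫ _, 2 * |k| ∂μ := by
      calc ∫ ω, ‖(-U) t ω‖ ∂μ ≤ ∫ ω, (U t ω + 2 * |k|) ∂μ := by
            refine integral_mono (hUint t).neg.norm ((hUint t).add (integrable_const _))
              fun ω => ?_
            have := hlow t ω
            have := le_abs_self k
            have := abs_nonneg k
            simp only [Pi.neg_apply, norm_neg, Real.norm_eq_abs]
            exact abs_le.2 ⟨by linarith, by linarith⟩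
        _ = ∫ ω, U t ω ∂μ + ∫ _, 2 * |k| ∂μ := integral_add (hUint t) (integrable_const _)
        _ ≤ _ := by gcongr
    have hneg : Integrable ((-U) t) μ := (hUint t).neg
    rw [eLpNorm_one_eq_lintegral_enorm, ← ofReal_integral_norm_eq_lintegral_enorm hneg]
    exact ENNReal.ofReal_le_ofReal hn
  filter_upwards [hsuper.neg.exists_ae_tendsto_of_bdd hbdd] with ω ⟨c, hc⟩
  have hUc : Tendsto (fun t => U t ω) atTop (𝓝 (-c)) := by simpa using hc.neg
  have hχs : Summable fun t => χ t ω :=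
    summable_of_sum_range_le (fun t => hχnn t ω) fun t => hχk t ω
  have hEq : ∀ t, U t ω = V t ω - ∑ s ∈ Finset.range t, χ s ω + ∑ s ∈ Finset.range t, η s ω :=
    fun t => by
      simp only [hU, hD, Pi.sub_apply, Finset.sum_apply, Finset.sum_sub_distrib]
      ring
  obtain ⟨b, hb⟩ := hUc.bddAbove_range
  have hηs : Summable fun t => η t ω :=
    summable_of_sum_range_le (c := b + k) (fun t => hηnn t ω) fun t => by
      linarith [hEq t, hVnn t ω, hχk t ω, hb (Set.mem_range_self t)]
  refine ⟨⟨_, ((hUc.add hχs.hasSum.tendsto_sum_nat).sub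
    hηs.hasSum.tendsto_sum_nat).congr fun t => ?_⟩, hηs⟩
  rw [hEq]
  ring

/-- The Robbins–Siegmund theorem for the processes multiplied by a weight `c` which is
predictable, takes values in `[0, 1]`, absorbs the multiplicative perturbation and keeps the
additive one uniformly bounded. -/
lemma ae_tendsto_and_summable_of_weight
    {Ω : Type*} {m0 : MeasurableSpace Ω} {μ : Measure Ω} [IsFiniteMeasure μ]
    (ℱ : Filtration ℕ m0) (V α χ η c : ℕ → Ω → ℝ)
    (hVad : Adapted ℱ V) (hχad : Adapted ℱ χ) (hηad : Adapted ℱ η)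
    (hVnn : ∀ t ω, 0 ≤ V t ω) (hχnn : ∀ t ω, 0 ≤ χ t ω) (hηnn : ∀ t ω, 0 ≤ η t ω)
    (hVint : ∀ t, Integrable (V t) μ) (hχint : ∀ t, Integrable (χ t) μ)
    (hηint : ∀ t, Integrable (η t) μ)
    (hcad : Adapted ℱ c) (hcpred : Adapted ℱ fun t => c (t + 1))
    (hcnn : ∀ t ω, 0 ≤ c t ω) (hcle : ∀ t ω, c t ω ≤ 1)
    (hcα : ∀ t ω, c (t + 1) ω * (1 + α t ω) ≤ c t ω) (k : ℝ)
    (hχk : ∀ t ω, ∑ s ∈ Finset.range t, c (s + 1) ω * χ s ω ≤ k)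
    (hrec : ∀ t : ℕ,
      μ[V (t + 1) | ℱ t] ≤ᵐ[μ] fun ω => V t ω * (1 + α t ω) + χ t ω - η t ω) :
    ∀ᵐ ω ∂μ, (∃ v, Tendsto (fun t => c t ω * V t ω) atTop (𝓝 v)) ∧
      Summable fun t => c (t + 1) ω * η t ω := by
  have hint : ∀ t (f : Ω → ℝ), Integrable f μ → Integrable (fun ω => c t ω * f ω) μ :=
    fun t f hf => hf.bdd_mul (c := 1) ((hcad t).mono (ℱ.le t) le_rfl).aestronglyMeasurable
      (ae_of_all _ fun ω => by
        rw [Real.norm_eq_abs, abs_of_nonneg (hcnn t ω)]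
        exact hcle t ω)
  refine ae_tendsto_and_summable_of_condExp_le_add_sub ℱ (fun t ω => c t ω * V t ω)
    (fun t ω => c (t + 1) ω * χ t ω) (fun t ω => c (t + 1) ω * η t ω)
    (fun t => (hcad t).mul (hVad t)) (fun t => (hcpred t).mul (hχad t))
    (fun t => (hcpred t).mul (hηad t)) (fun t ω => mul_nonneg (hcnn _ _) (hVnn _ _))
    (fun t ω => mul_nonneg (hcnn _ _) (hχnn _ _)) (fun t ω => mul_nonneg (hcnn _ _) (hηnn _ _))
    (fun t => hint _ _ (hVint _)) (fun t => hint _ _ (hχint _)) (fun t => hint _ _ (hηint _))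
    k hχk fun t => ?_
  have hpull : μ[fun ω => c (t + 1) ω * V (t + 1) ω | ℱ t] =ᵐ[μ]
      c (t + 1) * μ[V (t + 1) | ℱ t] :=
    condExp_mul_of_stronglyMeasurable_left (hcpred t).stronglyMeasurable
      (hint _ _ (hVint _)) (hVint _)
  filter_upwards [hpull, hrec t] with ω h1 h2
  rw [h1, Pi.mul_apply]
  have h3 := mul_le_mul_of_nonneg_left h2 (hcnn (t + 1) ω)
  have h4 := mul_le_mul_of_nonneg_right (hcα t ω) (hVnn t ω)
  linarith

/-- **Robbins–Siegmund theorem.** If `(V t)`, `(α t)`, `(χ t)`, `(η t)` are nonnegative,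
integrable processes adapted to a filtration `ℱ`, with `∑ α t < ∞` and `∑ χ t < ∞` a.s.,
and `E[V (t+1) | ℱ t] ≤ V t * (1 + α t) + χ t - η t` a.s. for every `t`, then `V t`
converges a.s. to a finite random variable and `∑ η t < ∞` a.s. -/
theorem robbins_siegmund
    {Ω : Type*} {m0 : MeasurableSpace Ω} {μ : Measure Ω} [IsProbabilityMeasure μ]
    (ℱ : Filtration ℕ m0)
    (V α χ η : ℕ → Ω → ℝ)
    (hVad : Adapted ℱ V) (hαad : Adapted ℱ α) (hχad : Adapted ℱ χ) (hηad : Adapted ℱ η)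
    (hVnn : ∀ t ω, 0 ≤ V t ω) (hαnn : ∀ t ω, 0 ≤ α t ω)
    (hχnn : ∀ t ω, 0 ≤ χ t ω) (hηnn : ∀ t ω, 0 ≤ η t ω)
    (hVint : ∀ t, Integrable (V t) μ) (hαint : ∀ t, Integrable (α t) μ)
    (hχint : ∀ t, Integrable (χ t) μ) (hηint : ∀ t, Integrable (η t) μ)
    (hαsum : ∀ᵐ ω ∂μ, Summable fun t => α t ω)
    (hχsum : ∀ᵐ ω ∂μ, Summable fun t => χ t ω)
    (hrec : ∀ t : ℕ,
      μ[V (t + 1) | ℱ t] ≤ᵐ[μ] fun ω => V t ω * (1 + α t ω) + χ t ω - η t ω) :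
    ∃ Vinf : Ω → ℝ,
      ∀ᵐ ω ∂μ,
        Tendsto (fun t => V t ω) atTop (𝓝 (Vinf ω)) ∧ Summable fun t => η t ω := by
  have hcore : ∀ k : ℕ, ∀ᵐ ω ∂μ,
      (∃ v, Tendsto (fun t => (if ∑ i ∈ Finset.range t, χ i ω ≤ (k : ℝ)
        then (∏ i ∈ Finset.range t, (1 + α i ω))⁻¹ else 0) * V t ω) atTop (𝓝 v)) ∧
      Summable fun t => (if ∑ i ∈ Finset.range (t + 1), χ i ω ≤ (k : ℝ)
        then (∏ i ∈ Finset.range (t + 1), (1 + α i ω))⁻¹ else 0) * η t ω := by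
    intro k
    have hP : ∀ t ω, 1 ≤ ∏ i ∈ Finset.range t, (1 + α i ω) := fun t ω =>
      Finset.one_le_prod fun i _ => by linarith [hαnn i ω]
    have hmeas : ∀ s t : ℕ, (∀ i ∈ Finset.range s, i ≤ t) →
        Measurable[ℱ t] fun ω => if ∑ i ∈ Finset.range s, χ i ω ≤ (k : ℝ)
          then (∏ i ∈ Finset.range s, (1 + α i ω))⁻¹ else 0 := by
      intro s t hst
      refine Measurable.ite (measurableSet_le (Finset.measurable_sum _ fun i hi =>
        (hχad i).mono (ℱ.mono (hst i hi)) le_rfl) measurable_const)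
        (Finset.measurable_prod _ fun i hi => ?_).inv measurable_const
      exact ((hαad i).mono (ℱ.mono (hst i hi)) le_rfl).const_add 1
    refine ae_tendsto_and_summable_of_weight ℱ V α χ η
      (fun t ω => if ∑ i ∈ Finset.range t, χ i ω ≤ (k : ℝ)
        then (∏ i ∈ Finset.range t, (1 + α i ω))⁻¹ else 0)
      hVad hχad hηad hVnn hχnn hηnn hVint hχint hηint
      (fun t => hmeas t t fun i hi => (Finset.mem_range.1 hi).le)
      (fun t => hmeas (t + 1) t fun i hi => Finset.mem_range_succ_iff.1 hi)
      (fun t ω => ?_) (fun t ω => ?_) (fun t ω => ?_) k (fun t ω => ?_) hrec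
    · have := hP t ω
      split_ifs <;> positivity
    · split_ifs
      exacts [inv_le_one_of_one_le₀ (hP t ω), zero_le_one]
    · have h0 : (0 : ℝ) < ∏ i ∈ Finset.range t, (1 + α i ω) := by linarith [hP t ω]
      have h1 : 0 < 1 + α t ω := by linarith [hαnn t ω]
      by_cases h : ∑ i ∈ Finset.range (t + 1), χ i ω ≤ (k : ℝ)
      · have h' : ∑ i ∈ Finset.range t, χ i ω ≤ (k : ℝ) := by
          rw [Finset.sum_range_succ] at h
          linarith [hχnn t ω]
        rw [if_pos h, if_pos h', Finset.prod_range_succ, mul_inv, mul_assoc,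
          inv_mul_cancel₀ h1.ne', mul_one]
      · rw [if_neg h, zero_mul]
        split_ifs <;> positivity
    · refine (Finset.sum_le_sum fun s _ => ?_).trans
        (sum_range_ite_le (fun n => hχnn n ω) k.cast_nonneg t)
      split_ifs
      · exact mul_le_of_le_one_left (hχnn s ω) (inv_le_one_of_one_le₀ (hP (s + 1) ω))
      · rw [zero_mul]
  have hconv : ∀ᵐ ω ∂μ, (∃ v, Tendsto (fun t => V t ω) atTop (𝓝 v)) ∧
      Summable fun t => η t ω := by
    filter_upwards [ae_all_iff.2 hcore, hαsum, hχsum] with ω hω hα hχ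
    obtain ⟨k, hk⟩ := exists_nat_ge (∑' t, χ t ω)
    have hle : ∀ t, ∑ i ∈ Finset.range t, χ i ω ≤ (k : ℝ) := fun t =>
      (hχ.sum_le_tsum _ fun i _ => hχnn i ω).trans hk
    have hP : ∀ t, 0 < ∏ i ∈ Finset.range t, (1 + α i ω) := fun t =>
      Finset.prod_pos fun i _ => by linarith [hαnn i ω]
    obtain ⟨⟨L, hL⟩, B, hB⟩ := exists_tendsto_prod_one_add (fun n => hαnn n ω) hα
    obtain ⟨⟨v, hv⟩, hs⟩ := hω k
    simp only [hle, if_true] at hv hs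
    refine ⟨⟨_, (hL.mul hv).congr fun t => mul_inv_cancel_left₀ (hP t).ne' _⟩,
      (hs.mul_left B).of_nonneg_of_le (fun t => hηnn t ω) fun t => ?_⟩
    calc η t ω = (∏ i ∈ Finset.range (t + 1), (1 + α i ω)) *
          ((∏ i ∈ Finset.range (t + 1), (1 + α i ω))⁻¹ * η t ω) :=
          (mul_inv_cancel_left₀ (hP _).ne' _).symm
      _ ≤ _ := mul_le_mul_of_nonneg_right (hB _)
          (mul_nonneg (inv_nonneg.2 (hP _).le) (hηnn t ω))
  refine ⟨fun ω => limUnder atTop fun t => V t ω, ?_⟩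
  filter_upwards [hconv] with ω hω
  exact ⟨tendsto_nhds_limUnder hω.1, hω.2⟩
end

section
/- Let $\mathcal{X} \subseteq \mathbb{R}^d$ be a compact convex set with diameter at most $R$, and let $f : \mathbb{R}^d \to \mathbb{R}$ be a convex function whose set of minimizers over $\mathcal{X}$ is nonempty, satisfying the acute angle condition on $\mathcal{X}$ with constant $\cos\phi > 0$ for some $\phi \in [0,\pi/2)$. Suppose the corruption probability satisfies $p < \cos\phi/(1+\cos\phi)$, fix $q \in [p, \cos\phi/(1+\cos\phi))$, set $\gamma = R / (2((1-q)\cos\phi - q))$ and step sizes $\gamma_t = \gamma/t$. Let $(x_t)_{t\ge 1}$ be the iterates of the normalized subgradient method under probabilistic corruption with these parameters, where each corruption indicator $Y_t$ is Bernoulli($p$) and independent of $x_t$. Then for every $T \ge 1$, $\mathbb{E}[\|x_{T+1} - x^\star(x_{T+1})\|^2] \le \gamma^2 (1 + \log T)/T$. -/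
open MeasureTheory ProbabilityTheory Filter Topology Classical
open scoped InnerProductSpace

/-- A nearest point to `z` in a convex set is at least as close to each point of the set
as `z` is. -/
theorem norm_nearest_sub_le {E : Type*} [NormedAddCommGroup E] [InnerProductSpace ℝ E]
    {K : Set E} (hK : Convex ℝ K) {z v y : E} (hv : v ∈ K)
    (hnear : ∀ w ∈ K, ‖v - z‖ ≤ ‖w - z‖) (hy : y ∈ K) : ‖v - y‖ ≤ ‖z - y‖ := by
  have hinf : ‖z - v‖ = ⨅ w : K, ‖z - w‖ := by
    have : Nonempty K := ⟨⟨v, hv⟩⟩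
    refine le_antisymm (le_ciInf fun w => ?_)
      (ciInf_le (f := fun w : K => ‖z - w‖) ⟨0, ?_⟩ ⟨v, hv⟩)
    · rw [norm_sub_rev z v, norm_sub_rev z]
      exact hnear w w.2
    · rintro _ ⟨w, rfl⟩
      exact norm_nonneg _
  have hinner := (norm_eq_iInf_iff_real_inner_le_zero hK hv).1 hinf y hy
  have hsq : ‖z - y‖ ^ 2 = ‖z - v‖ ^ 2 - 2 * ⟪z - v, y - v⟫_ℝ + ‖v - y‖ ^ 2 := by
    rw [norm_sub_rev v y, ← norm_sub_sq_real, sub_sub_sub_cancel_right]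
  refine le_of_sq_le_sq ?_ (norm_nonneg _)
  nlinarith [sq_nonneg ‖z - v‖]

/-- One normalized step of length `s` followed by a map that does not increase the distance
to `y`. -/
theorem sq_norm_normalized_step_le {E : Type*} [NormedAddCommGroup E] [InnerProductSpace ℝ E]
    {u v w y : E} {s c : ℝ} (hs : 0 ≤ s) (hv : v ≠ 0)
    (hw : ‖w - y‖ ≤ ‖u - (s * ‖v‖⁻¹) • v - y‖)
    (hc : c * ‖v‖ * ‖u - y‖ ≤ ⟪v, u - y⟫_ℝ) :
    ‖w - y‖ ^ 2 ≤ ‖u - y‖ ^ 2 - 2 * s * c * ‖u - y‖ + s ^ 2 := by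
  have hv0 : 0 < ‖v‖ := norm_pos_iff.2 hv
  have hsq : ‖u - (s * ‖v‖⁻¹) • v - y‖ ^ 2
      = ‖u - y‖ ^ 2 - 2 * s * (‖v‖⁻¹ * ⟪v, u - y⟫_ℝ) + s ^ 2 := by
    rw [sub_right_comm, norm_sub_sq_real, real_inner_smul_right, real_inner_comm, norm_smul,
      Real.norm_of_nonneg (by positivity), inv_mul_cancel_right₀ hv0.ne']
    ring
  have hc' : c * ‖u - y‖ ≤ ‖v‖⁻¹ * ⟪v, u - y⟫_ℝ := by
    rw [inv_mul_eq_div, le_div_iff₀ hv0]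
    linarith
  have := mul_le_mul_of_nonneg_left hc' hs
  have := pow_le_pow_left₀ (norm_nonneg _) hw 2
  linarith

/-- A sequence contracting by `1 - 1/t` up to an error `C / t²` decays like `log T / T`. -/
theorem le_log_div_of_recursion {a : ℕ → ℝ} {C : ℝ} (hC : 0 ≤ C)
    (ha : ∀ t : ℕ, 1 ≤ t → a (t + 1) ≤ (1 - 1 / (t : ℝ)) * a t + C / (t : ℝ) ^ 2)
    {T : ℕ} (hT : 1 ≤ T) : a (T + 1) ≤ C * (1 + Real.log T) / T := by
  have hsum : ∀ n : ℕ, (n : ℝ) * a (n + 1) ≤ C * (harmonic n : ℝ) := by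
    intro n
    induction n with
    | zero => simp
    | succ n ih =>
      have hn : (0 : ℝ) < (n : ℝ) + 1 := by positivity
      have h := mul_le_mul_of_nonneg_left (ha (n + 1) (by omega)) hn.le
      push_cast at h
      have e : ((n : ℝ) + 1) * ((1 - 1 / ((n : ℝ) + 1)) * a (n + 1) + C / ((n : ℝ) + 1) ^ 2)
          = n * a (n + 1) + C * ((n : ℝ) + 1)⁻¹ := by
        field_simp
        ring
      rw [harmonic_succ]
      push_cast
      linarith
  have hT0 : (0 : ℝ) < T := by exact_mod_cast hT
  rw [le_div_iff₀ hT0]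
  linarith [hsum T, mul_le_mul_of_nonneg_left (harmonic_le_one_add_log T) hC]

/-- Mean of a two-valued function of a Bernoulli variable times an independent variable. -/
theorem integral_two_valued_mul_of_indepFun {Ω : Type*} {mΩ : MeasurableSpace Ω}
    {μ : Measure Ω} [IsProbabilityMeasure μ] {p : ℝ} (hp : 0 ≤ p) {Y : Ω → Bool}
    (hY : Measurable Y) (hYp : μ {ω | Y ω = true} = ENNReal.ofReal p)
    {D : Ω → ℝ} (hD : AEStronglyMeasurable D μ) (hind : IndepFun Y D μ) (α β : ℝ) :
    ∫ ω, (if Y ω = true then α else β) * D ω ∂μ = (p * α + (1 - p) * β) * ∫ ω, D ω ∂μ := by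
  let ψ : Bool → ℝ := fun y => if y = true then α else β
  have hψ : Measurable ψ := measurable_of_finite _
  have hmul := (hind.comp hψ measurable_id).integral_fun_mul_eq_mul_integral
    (hψ.comp hY).aestronglyMeasurable hD
  simp only [Function.comp_apply, id_eq] at hmul
  have hset : MeasurableSet {ω | Y ω = true} := hY (measurableSet_singleton true)
  have hmean : ∫ ω, ψ (Y ω) ∂μ = p * α + (1 - p) * β := by
    have e : ∀ ω, ψ (Y ω) = β + {ω | Y ω = true}.indicator (fun _ => α - β) ω := by
      intro ω
      by_cases hω : Y ω = true <;> simp [ψ, hω]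
    simp_rw [e]
    rw [integral_add (integrable_const _) ((integrable_const _).indicator hset),
      integral_indicator_const _ hset]
    simp only [integral_const, measureReal_def, measure_univ, hYp, ENNReal.toReal_ofReal hp,
      ENNReal.toReal_one, smul_eq_mul]
    ring
  rw [← hmean]
  exact hmul

/-- **Theorem 2 (rate), convex case.** For a convex function satisfying the acute angle
condition with constant `cos φ` on a compact convex set of diameter at most `R`, if the
corruption probability `p` is below `cos φ/(1 + cos φ)`, the normalized subgradient
method with step sizes `γ_t = γ/t`, `γ = R/(2((1-q) cos φ - q))`, satisfies
`E[‖x_{T+1} - x⋆(x_{T+1})‖²] ≤ γ² (1 + log T)/T`. -/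
theorem nsm_convex_rate
    {d : ℕ} {Ω : Type*} {mΩ : MeasurableSpace Ω}
    (μprob : Measure Ω) [IsProbabilityMeasure μprob]
    -- the constraint set: compact, convex, diameter at most `R`
    (X : Set (EuclideanSpace ℝ (Fin d))) (hXne : X.Nonempty)
    (hXcompact : IsCompact X) (hXconv : Convex ℝ X)
    (R : ℝ) (hR : 0 < R)
    (hdiam : ∀ x₁ ∈ X, ∀ x₂ ∈ X, ‖x₁ - x₂‖ ≤ R)
    -- the objective: convex, with nonempty set `S` of minimizers over `X`
    (f : EuclideanSpace ℝ (Fin d) → ℝ) (hfconv : ConvexOn ℝ Set.univ f)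
    (S : Set (EuclideanSpace ℝ (Fin d)))
    (hS : S = {y ∈ X | ∀ z ∈ X, f y ≤ f z}) (hSne : S.Nonempty)
    -- `xstar z` is the minimizer nearest to `z`
    (xstar : EuclideanSpace ℝ (Fin d) → EuclideanSpace ℝ (Fin d))
    (hxstarS : ∀ z, xstar z ∈ S)
    (hxstar_near : ∀ z, ∀ y ∈ S, ‖z - xstar z‖ ≤ ‖z - y‖)
    (hxstar_meas : Measurable xstar)
    -- the acute angle condition with constant `cos φ`, `φ ∈ [0, π/2)`
    (φ : ℝ) (hφ0 : 0 ≤ φ) (hφ1 : φ < Real.pi / 2)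
    (hacute : ∀ z ∈ X, ∀ v : EuclideanSpace ℝ (Fin d),
      (∀ y, f z + ⟪v, y - z⟫_ℝ ≤ f y) →
      Real.cos φ * ‖v‖ * ‖z - xstar z‖ ≤ ⟪v, z - xstar z⟫_ℝ)
    -- corruption probability and step-size parameters
    (p q γ : ℝ) (hp0 : 0 ≤ p) (hpq : p ≤ q)
    (hq : q < Real.cos φ / (1 + Real.cos φ))
    (hγ : γ = R / (2 * ((1 - q) * Real.cos φ - q)))
    -- Euclidean projection onto `X`
    (proj : EuclideanSpace ℝ (Fin d) → EuclideanSpace ℝ (Fin d))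
    (hprojX : ∀ z, proj z ∈ X)
    (hproj_near : ∀ z, ∀ y ∈ X, ‖proj z - z‖ ≤ ‖y - z‖)
    -- the iterates, feedback, corruptions and corruption indicators
    (x h b g : ℕ → Ω → EuclideanSpace ℝ (Fin d)) (Y : ℕ → Ω → Bool)
    (hxmeas : ∀ t, Measurable (x t)) (hbmeas : ∀ t, Measurable (b t))
    (hgmeas : ∀ t, Measurable (g t)) (hYmeas : ∀ t, Measurable (Y t))
    (hx1 : ∀ ω, x 1 ω ∈ X)
    -- `g t` is a subgradient of `f` at `x t`
    (hgsub : ∀ t ω, ∀ y, f (x t ω) + ⟪g t ω, y - x t ω⟫_ℝ ≤ f y)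
    -- the received feedback: corrupted with probability `p`
    (hfeed : ∀ t ω, h t ω = if Y t ω = true then b t ω else g t ω)
    (hYp : ∀ t, μprob {ω | Y t ω = true} = ENNReal.ofReal p)
    (hYindep : ∀ t, IndepFun (Y t) (x t) μprob)
    -- the normalized subgradient update with step size `γ/t`
    (hupdate : ∀ t : ℕ, 1 ≤ t → ∀ ω,
      x (t + 1) ω =
        if h t ω ≠ 0 then
          proj (x t ω - ((γ / (t : ℝ)) * ‖h t ω‖⁻¹) • h t ω)
        else x t ω) :
    ∀ T : ℕ, 1 ≤ T →
      ∫ ω, ‖x (T + 1) ω - xstar (x (T + 1) ω)‖ ^ 2 ∂μprob ≤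
        γ ^ 2 * (1 + Real.log T) / T := by
  intro T hT
  have hcos : 0 < Real.cos φ :=
    Real.cos_pos_of_mem_Ioo ⟨by linarith [Real.pi_pos], hφ1⟩
  have hc : 0 < (1 - q) * Real.cos φ - q := by
    rw [lt_div_iff₀ (by linarith)] at hq
    linarith
  have hγ0 : 0 < γ := by rw [hγ]; positivity
  have hγR : 2 * γ * ((1 - q) * Real.cos φ - q) = R := by
    rw [hγ]
    field_simp
  have hSX : S ⊆ X := by
    rw [hS]
    exact fun y hy => hy.1
  have hxX : ∀ t, 1 ≤ t → ∀ ω, x t ω ∈ X := by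
    intro t ht ω
    induction t, ht using Nat.le_induction with
    | base => exact hx1 ω
    | succ t ht ih =>
      rw [hupdate t ht ω]
      split_ifs
      exacts [hprojX _, ih]
  let D : ℕ → Ω → ℝ := fun t ω => ‖x t ω - xstar (x t ω)‖
  have hD0 : ∀ t ω, 0 ≤ D t ω := fun t ω => norm_nonneg _
  have hDR : ∀ t, 1 ≤ t → ∀ ω, D t ω ≤ R := fun t ht ω =>
    hdiam _ (hxX t ht ω) _ (hSX (hxstarS _))
  have hnorm : Measurable fun z => ‖z - xstar z‖ := (measurable_id.sub hxstar_meas).norm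
  have hDmeas : ∀ t, Measurable (D t) := fun t => hnorm.comp (hxmeas t)
  have hstep : ∀ t, 1 ≤ t → ∀ ω, D (t + 1) ω ^ 2 ≤ D t ω ^ 2
      - 2 * (γ / t) * ((if Y t ω = true then -1 else Real.cos φ) * D t ω) + (γ / t) ^ 2 := by
    intro t ht ω
    have hs : 0 ≤ γ / t := by positivity
    by_cases hh : h t ω = 0
    · have hx : x (t + 1) ω = x t ω := by simp [hupdate t ht ω, hh]
      have hDeq : D (t + 1) ω = D t ω := by simp only [D, hx]
      rw [hDeq]
      by_cases hY : Y t ω = true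
      · rw [if_pos hY]
        have := mul_nonneg hs (hD0 t ω)
        nlinarith [sq_nonneg (γ / t)]
      · have hg : g t ω = 0 := by simpa [hfeed t ω, hY] using hh
        have hxS : x t ω ∈ S := by
          rw [hS]
          refine ⟨hxX t ht ω, fun z _ => ?_⟩
          simpa [hg] using hgsub t ω z
        have hDz : D t ω = 0 :=
          le_antisymm ((hxstar_near (x t ω) _ hxS).trans_eq (by simp)) (hD0 t ω)
        rw [hDz]
        nlinarith [sq_nonneg (γ / t)]
    · have hx := hupdate t ht ω
      rw [if_pos hh] at hx
      have hmem : xstar (x t ω) ∈ X := hSX (hxstarS _)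
      have hw : ‖x (t + 1) ω - xstar (x t ω)‖
          ≤ ‖x t ω - ((γ / t) * ‖h t ω‖⁻¹) • h t ω - xstar (x t ω)‖ := by
        rw [hx]
        exact norm_nearest_sub_le hXconv (hprojX _) (hproj_near _) hmem
      have hangle : (if Y t ω = true then -1 else Real.cos φ) * ‖h t ω‖
          * ‖x t ω - xstar (x t ω)‖ ≤ ⟪h t ω, x t ω - xstar (x t ω)⟫_ℝ := by
        split_ifs with hY
        · linarith [neg_le_of_abs_le (abs_real_inner_le_norm (h t ω) (x t ω - xstar (x t ω)))]
        · have hg : h t ω = g t ω := by simp [hfeed t ω, hY]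
          rw [hg]
          exact hacute _ (hxX t ht ω) _ (hgsub t ω)
      have h1 := sq_norm_normalized_step_le hs hh hw hangle
      have h2 : D (t + 1) ω ^ 2 ≤ ‖x (t + 1) ω - xstar (x t ω)‖ ^ 2 :=
        pow_le_pow_left₀ (norm_nonneg _) (hxstar_near _ _ (hxstarS _)) 2
      simp only [D] at h2 ⊢
      linarith
  have hDint : ∀ t, 1 ≤ t → Integrable (D t) μprob := fun t ht =>
    Integrable.of_bound (hDmeas t).aestronglyMeasurable R
      (ae_of_all _ fun ω => by
        rw [Real.norm_of_nonneg (hD0 t ω)]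
        exact hDR t ht ω)
  have hDsq : ∀ t, 1 ≤ t → Integrable (fun ω => D t ω ^ 2) μprob := fun t ht =>
    Integrable.of_bound ((hDmeas t).pow_const 2).aestronglyMeasurable (R ^ 2)
      (ae_of_all _ fun ω => by
        rw [Real.norm_of_nonneg (sq_nonneg _)]
        exact pow_le_pow_left₀ (hD0 t ω) (hDR t ht ω) 2)
  refine le_log_div_of_recursion (a := fun t => ∫ ω, D t ω ^ 2 ∂μprob) (sq_nonneg γ) ?_ hT
  intro t ht
  have ht0 : (0 : ℝ) < t := by exact_mod_cast ht
  have hψint : Integrable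
      (fun ω => (if Y t ω = true then -1 else Real.cos φ) * D t ω) μprob := by
    refine (hDint t ht).bdd_mul (c := 1)
      ((measurable_of_finite fun y : Bool => if y = true then (-1 : ℝ) else Real.cos φ).comp
        (hYmeas t)).aestronglyMeasurable (ae_of_all _ fun ω => ?_)
    by_cases hY : Y t ω = true <;> simp [hY, Real.abs_cos_le_one]
  have hind : IndepFun (Y t) (D t) μprob := (hYindep t).comp measurable_id hnorm
  have hmean := integral_two_valued_mul_of_indepFun hp0 (hYmeas t) (hYp t)
    (hDmeas t).aestronglyMeasurable hind (-1) (Real.cos φ)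
  have hE : ∫ ω, D (t + 1) ω ^ 2 ∂μprob ≤ ∫ ω, D t ω ^ 2 ∂μprob
      - 2 * (γ / t) * ((p * -1 + (1 - p) * Real.cos φ) * ∫ ω, D t ω ∂μprob) + (γ / t) ^ 2 := by
    have hmono := integral_mono (hDsq (t + 1) (by omega))
      (((hDsq t ht).sub (hψint.const_mul (2 * (γ / t)))).add (integrable_const ((γ / t) ^ 2)))
      (hstep t ht)
    refine hmono.trans_eq ?_
    rw [integral_add' ((hDsq t ht).sub (hψint.const_mul _)) (integrable_const _),
      integral_sub' (hDsq t ht) (hψint.const_mul _), integral_const_mul, hmean]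
    simp
  have hsqle : ∫ ω, D t ω ^ 2 ∂μprob ≤ R * ∫ ω, D t ω ∂μprob := by
    rw [← integral_const_mul]
    refine integral_mono (hDsq t ht) ((hDint t ht).const_mul R) fun ω => ?_
    simp only [sq]
    exact mul_le_mul_of_nonneg_right (hDR t ht ω) (hD0 t ω)
  have hE0 : 0 ≤ ∫ ω, D t ω ∂μprob := integral_nonneg (hD0 t)
  have hcp : (1 - q) * Real.cos φ - q ≤ p * -1 + (1 - p) * Real.cos φ := by
    nlinarith
  have hdrift : 1 / (t : ℝ) * ∫ ω, D t ω ^ 2 ∂μprob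
      ≤ 2 * (γ / t) * ((p * -1 + (1 - p) * Real.cos φ) * ∫ ω, D t ω ∂μprob) := by
    calc 1 / (t : ℝ) * ∫ ω, D t ω ^ 2 ∂μprob
        ≤ 1 / (t : ℝ) * (R * ∫ ω, D t ω ∂μprob) := by gcongr
      _ = 2 * (γ / t) * (((1 - q) * Real.cos φ - q) * ∫ ω, D t ω ∂μprob) := by
        rw [← hγR]
        ring
      _ ≤ _ := by gcongr
  rw [← div_pow]
  linarith
end

section
/- Let $\mathcal{X} \subseteq \mathbb{R}^d$ be a compact convex set with diameter at most $R$ that contains a nonempty open ball centered at the unique minimizer $x^\star$ of $f$ over $\mathcal{X}$, and let $f : \mathbb{R}^d \to \mathbb{R}$ be differentiable, $\mu$-strongly convex, and $\beta$-smooth on $\mathcal{X}$, with condition number $\kappa = \beta/\mu$. Suppose the corruption probability satisfies $p < 1/(1+\kappa)$, fix $q \in [p, 1/(1+\kappa))$, set $\gamma = \kappa R / (2((1-q) - q\kappa))$ and step sizes $\gamma_t = \gamma/t$. Let $(x_t)_{t\ge 1}$ be the iterates of the normalized subgradient method under probabilistic corruption with these parameters, where each corruption indicator $Y_t$ is Bernoulli($p$)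 and independent of $x_t$. Then $x_t \to x^\star$ almost surely. -/
open MeasureTheory ProbabilityTheory Filter Topology Classical
open scoped InnerProductSpace

/-- A nearest-point map onto a convex set moves points closer to every point of the set. -/
theorem norm_nearestPoint_sub_le {E : Type*} [NormedAddCommGroup E] [InnerProductSpace ℝ E]
    {X : Set E} (hX : Convex ℝ X) {z v y : E} (hv : v ∈ X)
    (hnear : ∀ w ∈ X, ‖v - z‖ ≤ ‖w - z‖) (hy : y ∈ X) : ‖v - y‖ ≤ ‖z - y‖ := by
  have hne : Nonempty X := ⟨⟨v, hv⟩⟩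
  have hinf : ‖z - v‖ = ⨅ w : X, ‖z - w‖ := by
    refine le_antisymm (le_ciInf fun w => ?_) ?_
    · simpa only [norm_sub_rev] using hnear w w.2
    · exact ciInf_le ⟨0, by rintro _ ⟨w, rfl⟩; positivity⟩ (⟨v, hv⟩ : X)
  have hinner := (norm_eq_iInf_iff_real_inner_le_zero hX hv).1 hinf y hy
  have hexp : ‖z - y‖ ^ 2 = ‖z - v‖ ^ 2 - 2 * ⟪z - v, y - v⟫_ℝ + ‖v - y‖ ^ 2 := by
    rw [← norm_sub_rev y v, ← norm_sub_sq_real]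
    congr 2
    abel
  refine le_of_sq_le_sq ?_ (norm_nonneg _)
  nlinarith [sq_nonneg ‖z - v‖]

/-- The squared distance to a point after a normalized step of length `η`. -/
theorem norm_normalized_step_sub_sq {E : Type*} [NormedAddCommGroup E] [InnerProductSpace ℝ E]
    (x s g : E) (hg : g ≠ 0) (η : ℝ) :
    ‖x - (η * ‖g‖⁻¹) • g - s‖ ^ 2
      = ‖x - s‖ ^ 2 + η ^ 2 - 2 * η * (‖g‖⁻¹ * ⟪g, x - s⟫_ℝ) := by
  have h0 : ‖g‖ ≠ 0 := norm_ne_zero_iff.2 hg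
  rw [sub_right_comm, norm_sub_sq_real, real_inner_smul_right, norm_smul, mul_pow,
    Real.norm_eq_abs, sq_abs, real_inner_comm]
  field_simp
  ring

/-- A recursion `a (t + 1) ≤ (1 - 1 / t) a t + c / t ^ 2` forces `t * a (t + 1) ≤ 2 c √t`. -/
theorem mul_le_sqrt_of_recursion {a : ℕ → ℝ} {c : ℝ} (hc : 0 ≤ c)
    (ha : ∀ t : ℕ, 1 ≤ t → a (t + 1) ≤ a t - a t / t + c / (t : ℝ) ^ 2) (t : ℕ) :
    t * a (t + 1) ≤ 2 * c * √t := by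
  have hstep : ∀ s : ℕ, (s : ℝ) * a (s + 1) ≤ 2 * c * √s →
      ((s + 1 : ℕ) : ℝ) * a (s + 1 + 1) ≤ 2 * c * √((s + 1 : ℕ) : ℝ) := by
    intro s hs
    have h := ha (s + 1) (by omega)
    push_cast at h ⊢
    have hs0 : (0 : ℝ) < (s : ℝ) + 1 := by positivity
    have h2 : ((s : ℝ) + 1) * a (s + 1 + 1) ≤ s * a (s + 1) + c / (s + 1) := by
      calc ((s : ℝ) + 1) * a (s + 1 + 1)
          ≤ (s + 1) * (a (s + 1) - a (s + 1) / (s + 1) + c / (s + 1) ^ 2) := by gcongr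
        _ = s * a (s + 1) + c / (s + 1) := by field_simp; ring
    have hu : √(s : ℝ) ^ 2 = s := Real.sq_sqrt (by positivity)
    have hv : √((s : ℝ) + 1) ^ 2 = s + 1 := Real.sq_sqrt hs0.le
    have hv1 : 1 ≤ √((s : ℝ) + 1) := Real.one_le_sqrt.2 (by linarith [s.cast_nonneg (α := ℝ)])
    have huv : √(s : ℝ) ≤ √((s : ℝ) + 1) := Real.sqrt_le_sqrt (by linarith)
    have hkey : 1 / ((s : ℝ) + 1) ≤ 2 * (√((s : ℝ) + 1) - √s) := by
      have hmul : (√((s : ℝ) + 1) - √s) * √((s : ℝ) + 1)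
          ≤ (√((s : ℝ) + 1) - √s) * √((s : ℝ) + 1) ^ 2 :=
        mul_le_mul_of_nonneg_left (by nlinarith) (sub_nonneg.2 huv)
      rw [hv] at hmul
      rw [div_le_iff₀ hs0]
      nlinarith [sq_nonneg (√((s : ℝ) + 1) - √s)]
    have := mul_le_mul_of_nonneg_left hkey hc
    rw [mul_one_div] at this
    linarith
  induction t with
  | zero => simp
  | succ s ih => exact hstep s ih

/-- Nonnegative integrable functions with summable integrals tend to zero almost everywhere. -/
theorem ae_tendsto_zero_of_summable_integral {Ω : Type*} {mΩ : MeasurableSpace Ω}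
    {P : Measure Ω} {F : ℕ → Ω → ℝ} (hF : ∀ k, Integrable (F k) P) (hF0 : ∀ k ω, 0 ≤ F k ω)
    (hsum : Summable fun k => ∫ ω, F k ω ∂P) :
    ∀ᵐ ω ∂P, Tendsto (fun k => F k ω) atTop (𝓝 0) := by
  have hlt : ∫⁻ ω, ∑' k, ENNReal.ofReal (F k ω) ∂P ≠ ⊤ := by
    rw [lintegral_tsum fun k => (hF k).aemeasurable.ennreal_ofReal]
    simp_rw [← fun k => ofReal_integral_eq_lintegral_ofReal (hF k) (ae_of_all _ (hF0 k))]
    exact hsum.tsum_ofReal_ne_top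
  filter_upwards [ae_lt_top' (AEMeasurable.tsum
    fun k => (hF k).aemeasurable.ennreal_ofReal) hlt] with ω hω
  have h := ENNReal.tendsto_toReal_zero_iff (fun k => ENNReal.ofReal_ne_top) |>.2
    (ENNReal.tendsto_atTop_zero_of_tsum_ne_top hω.ne)
  simpa only [ENNReal.toReal_ofReal (hF0 _ ω)] using h

/-- A sequence with increments of size `O(1 / t)` converges as soon as it converges along the
subsequence `k ^ 4 + 1`. -/
theorem tendsto_of_tendsto_pow_four {E : Type*} [NormedAddCommGroup E] {x : ℕ → E} {s : E}
    {c : ℝ} (hc : 0 ≤ c) (hinc : ∀ t : ℕ, 1 ≤ t → ‖x (t + 1) - x t‖ ≤ c / t)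
    (hsub : Tendsto (fun k : ℕ => x (k ^ 4 + 1)) atTop (𝓝 s)) :
    Tendsto x atTop (𝓝 s) := by
  have hmove : ∀ m : ℕ, 1 ≤ m → ∀ j : ℕ, ‖x (m + j) - x m‖ ≤ j * (c / m) := by
    intro m hm j
    induction j with
    | zero => simp
    | succ j ih =>
      have h1 := hinc (m + j) (by omega)
      have h2 : c / ((m + j : ℕ) : ℝ) ≤ c / m := by
        gcongr
        omega
      calc ‖x (m + (j + 1)) - x m‖ ≤ ‖x (m + (j + 1)) - x (m + j)‖ + ‖x (m + j) - x m‖ :=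
            norm_sub_le_norm_sub_add_norm_sub _ _ _
        _ ≤ c / m + j * (c / m) := add_le_add (h1.trans h2) ih
        _ = ((j + 1 : ℕ) : ℝ) * (c / m) := by push_cast; ring
  have hsqrt : Tendsto Nat.sqrt atTop atTop :=
    tendsto_atTop.2 fun b => by
      filter_upwards [eventually_ge_atTop (b * b)] with n hn using Nat.le_sqrt.2 hn
  set r : ℕ → ℕ := fun n => (n - 1).sqrt.sqrt with hr_def
  have hr : Tendsto r atTop atTop := hsqrt.comp (hsqrt.comp (tendsto_sub_atTop_nat 1))
  have hbound : ∀ᶠ n in atTop, ‖x n - s‖ ≤ 15 * c / (r n : ℝ) + ‖x (r n ^ 4 + 1) - s‖ := by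
    filter_upwards [hr.eventually_ge_atTop 1, eventually_ge_atTop 1] with n hrn hn
    have hlo : r n ^ 4 + 1 ≤ n := by
      have h1 : r n * r n ≤ (n - 1).sqrt := Nat.sqrt_le _
      have h2 := Nat.sqrt_le (n - 1)
      have h3 := Nat.mul_le_mul h1 h1
      have h4 : r n ^ 4 = r n * r n * (r n * r n) := by ring
      omega
    have hhi : n ≤ (r n + 1) ^ 4 := by
      have h1 : (n - 1).sqrt + 1 ≤ (r n + 1) * (r n + 1) := Nat.lt_succ_sqrt _
      have h2 : n - 1 < ((n - 1).sqrt + 1) * ((n - 1).sqrt + 1) := Nat.lt_succ_sqrt _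
      have h3 := Nat.mul_le_mul h1 h1
      have h4 : (r n + 1) ^ 4 = (r n + 1) * (r n + 1) * ((r n + 1) * (r n + 1)) := by ring
      omega
    obtain ⟨j, hj⟩ := Nat.exists_eq_add_of_le hlo
    have hm := hmove (r n ^ 4 + 1) (by omega) j
    rw [← hj] at hm
    have hk : (1 : ℝ) ≤ r n := by exact_mod_cast hrn
    have hj' : (j : ℝ) ≤ 15 * (r n : ℝ) ^ 3 := by
      have h1 : (r n : ℝ) ^ 4 + 1 + j ≤ ((r n : ℝ) + 1) ^ 4 := by
        have := hj.symm.le.trans hhi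
        exact_mod_cast this
      nlinarith [mul_nonneg (sub_nonneg.2 hk) (sub_nonneg.2 hk),
        pow_le_pow_right₀ hk (show 2 ≤ 3 by omega), pow_le_pow_right₀ hk (show 1 ≤ 3 by omega)]
    have hle : (j : ℝ) * (c / ((r n ^ 4 + 1 : ℕ) : ℝ)) ≤ 15 * c / (r n : ℝ) := by
      push_cast
      calc (j : ℝ) * (c / ((r n : ℝ) ^ 4 + 1)) ≤ 15 * (r n : ℝ) ^ 3 * (c / (r n : ℝ) ^ 4) := by
            gcongr
            linarith
        _ = 15 * c / (r n : ℝ) := by field_simp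
    calc ‖x n - s‖ ≤ ‖x n - x (r n ^ 4 + 1)‖ + ‖x (r n ^ 4 + 1) - s‖ :=
          norm_sub_le_norm_sub_add_norm_sub _ _ _
      _ ≤ _ := by gcongr; exact hm.trans hle
  rw [tendsto_iff_norm_sub_tendsto_zero]
  refine squeeze_zero' (Eventually.of_forall fun _ => norm_nonneg _) hbound ?_
  have h1 : Tendsto (fun n => 15 * c / (r n : ℝ)) atTop (𝓝 0) :=
    (tendsto_const_div_atTop_nhds_zero_nat (15 * c)).comp hr
  have h2 := (tendsto_iff_norm_sub_tendsto_zero.1 hsub).comp hr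
  simpa using h1.add h2

/-- An event independent of `Z` with probability `p` contributes `p * ∫ Z`. -/
theorem integral_ite_mul_of_indepFun {Ω E : Type*} {mΩ : MeasurableSpace Ω}
    [MeasurableSpace E] {P : Measure Ω} {Y : Ω → Bool} {Z : Ω → E} {p : ℝ} (hp : 0 ≤ p)
    (hY : Measurable Y) (hZ : Measurable Z) (hYp : P {ω | Y ω = true} = ENNReal.ofReal p)
    (hind : IndepFun Y Z P) {φ : E → ℝ} (hφ : Measurable φ) :
    ∫ ω, (if Y ω = true then 1 else 0) * φ (Z ω) ∂P = p * ∫ ω, φ (Z ω) ∂P := by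
  have hψ : Measurable fun y : Bool => (if y = true then (1 : ℝ) else 0) := measurable_of_finite _
  have h := (hind.comp hψ hφ).integral_fun_mul_eq_mul_integral
    (hψ.comp hY).aestronglyMeasurable (hφ.comp hZ).aestronglyMeasurable
  simp only [Function.comp_apply] at h
  rw [h]
  congr 1
  have hms : MeasurableSet {ω | Y ω = true} := hY (measurableSet_singleton true)
  have : (fun ω => if Y ω = true then (1 : ℝ) else 0) = {ω | Y ω = true}.indicator 1 := by
    ext ω
    simp [Set.indicator_apply]
  rw [this, integral_indicator_one hms, measureReal_def, hYp, ENNReal.toReal_ofReal hp]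

/-- Under `μ`-strong monotonicity and `β`-smoothness, the normalized gradient has a component of
size at least `μ / β` towards a zero of the gradient. -/
theorem norm_sub_le_mul_inner_normalized {E : Type*} [NormedAddCommGroup E]
    [InnerProductSpace ℝ E] {g v : E} {μ β : ℝ} (hμ : 0 < μ) (hg : g ≠ 0)
    (hsmooth : ‖g‖ ≤ β * ‖v‖) (hstrong : μ * ‖v‖ ^ 2 ≤ ⟪g, v⟫_ℝ) :
    ‖v‖ ≤ β / μ * (‖g‖⁻¹ * ⟪g, v⟫_ℝ) := by
  have hg0 : 0 < ‖g‖ := norm_pos_iff.2 hg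
  have hv : 0 ≤ ‖v‖ := norm_nonneg v
  have hβ : 0 ≤ β := by
    by_contra! hneg
    nlinarith
  calc ‖v‖ = ‖v‖ * ‖g‖ * ‖g‖⁻¹ := by field_simp
    _ ≤ ‖v‖ * (β * ‖v‖) * ‖g‖⁻¹ := by gcongr
    _ = β / μ * (‖g‖⁻¹ * (μ * ‖v‖ ^ 2)) := by field_simp
    _ ≤ β / μ * (‖g‖⁻¹ * ⟪g, v⟫_ℝ) := by gcongr

/-- **Corollary 1 (almost sure convergence), strongly convex case.** Under the same
assumptions as the rate statement, the iterates of the normalized subgradient method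
under probabilistic corruption converge almost surely to the unique minimizer `x⋆`. -/
theorem nsm_strongly_convex_as_convergence
    {d : ℕ} {Ω : Type*} {mΩ : MeasurableSpace Ω}
    (μprob : Measure Ω) [IsProbabilityMeasure μprob]
    -- the constraint set: compact, convex, diameter at most `R`
    (X : Set (EuclideanSpace ℝ (Fin d))) (hXne : X.Nonempty)
    (hXcompact : IsCompact X) (hXconv : Convex ℝ X)
    (R : ℝ) (hR : 0 < R)
    (hdiam : ∀ x₁ ∈ X, ∀ x₂ ∈ X, ‖x₁ - x₂‖ ≤ R)
    -- the objective: differentiable, `μ`-strongly convex and `β`-smooth on `X`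
    (f : EuclideanSpace ℝ (Fin d) → ℝ)
    (hdiff : ∀ z ∈ X, DifferentiableAt ℝ f z)
    (μ β κ : ℝ) (hμ : 0 < μ) (hβ : 0 < β) (hκ : κ = β / μ)
    (hsmooth : ∀ x₁ ∈ X, ∀ x₂ ∈ X,
      ‖gradient f x₁ - gradient f x₂‖ ≤ β * ‖x₁ - x₂‖)
    (hstrong : ∀ x₁ ∈ X, ∀ x₂ ∈ X,
      μ * ‖x₁ - x₂‖ ^ 2 ≤ ⟪gradient f x₁ - gradient f x₂, x₁ - x₂⟫_ℝ)
    -- `xs` is the unique minimizer of `f` over `X`, and `X` contains a ball around it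
    (xs : EuclideanSpace ℝ (Fin d)) (hxsX : xs ∈ X)
    (hxsmin : ∀ y ∈ X, f xs ≤ f y)
    (hxsuniq : ∀ y ∈ X, (∀ z ∈ X, f y ≤ f z) → y = xs)
    (hball : ∃ ε > 0, Metric.ball xs ε ⊆ X)
    -- corruption probability and step-size parameters
    (p q γ : ℝ) (hp0 : 0 ≤ p) (hpq : p ≤ q)
    (hq : q < 1 / (1 + κ))
    (hγ : γ = κ * R / (2 * ((1 - q) - q * κ)))
    -- Euclidean projection onto `X`
    (proj : EuclideanSpace ℝ (Fin d) → EuclideanSpace ℝ (Fin d))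
    (hprojX : ∀ z, proj z ∈ X)
    (hproj_near : ∀ z, ∀ y ∈ X, ‖proj z - z‖ ≤ ‖y - z‖)
    -- the iterates, feedback, corruptions and corruption indicators
    (x h b : ℕ → Ω → EuclideanSpace ℝ (Fin d)) (Y : ℕ → Ω → Bool)
    (hxmeas : ∀ t, Measurable (x t)) (hbmeas : ∀ t, Measurable (b t))
    (hYmeas : ∀ t, Measurable (Y t))
    (hx1 : ∀ ω, x 1 ω ∈ X)
    -- the received feedback: corrupted with probability `p`
    (hfeed : ∀ t ω, h t ω = if Y t ω = true then b t ω else gradient f (x t ω))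
    (hYp : ∀ t, μprob {ω | Y t ω = true} = ENNReal.ofReal p)
    (hYindep : ∀ t, IndepFun (Y t) (x t) μprob)
    -- the normalized subgradient update with step size `γ/t`
    (hupdate : ∀ t : ℕ, 1 ≤ t → ∀ ω,
      x (t + 1) ω =
        if h t ω ≠ 0 then
          proj (x t ω - ((γ / (t : ℝ)) * ‖h t ω‖⁻¹) • h t ω)
        else x t ω) :
    ∀ᵐ ω ∂μprob, Tendsto (fun t => x t ω) atTop (𝓝 xs) := by
  have hκ0 : 0 < κ := hκ ▸ div_pos hβ hμ
  have hs : 0 < (1 - q) - q * κ := by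
    rw [lt_div_iff₀ (by positivity)] at hq
    linarith
  have hγ0 : 0 < γ := by rw [hγ]; positivity
  have hγs : 2 * γ * ((1 - q) - q * κ) = κ * R := by
    rw [hγ, mul_right_comm]
    exact mul_div_cancel₀ _ (by positivity)
  obtain ⟨ε, hε, hεX⟩ := hball
  have hgrad : gradient f xs = 0 := by
    have hmin : IsLocalMin f xs := by
      filter_upwards [Metric.ball_mem_nhds xs hε] with y hy using hxsmin y (hεX hy)
    simp [gradient, hmin.fderiv_eq_zero]
  have hxX : ∀ t : ℕ, 1 ≤ t → ∀ ω, x t ω ∈ X := by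
    intro t ht ω
    induction t, ht using Nat.le_induction with
    | base => exact hx1 ω
    | succ t ht ih =>
      rw [hupdate t ht ω]
      split_ifs
      · exact hprojX _
      · exact ih
  have hnonexp : ∀ z, ∀ y ∈ X, ‖proj z - y‖ ≤ ‖z - y‖ := fun z y hy =>
    norm_nearestPoint_sub_le hXconv (hprojX z) (hproj_near z) hy
  have hinc : ∀ ω, ∀ t : ℕ, 1 ≤ t → ‖x (t + 1) ω - x t ω‖ ≤ γ / t := by
    intro ω t ht
    rw [hupdate t ht ω]
    split_ifs with h0
    · refine (hnonexp _ _ (hxX t ht ω)).trans_eq ?_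
      have : ‖h t ω‖ ≠ 0 := norm_ne_zero_iff.2 h0
      rw [sub_sub_cancel_left, norm_neg, norm_smul, norm_mul, norm_inv, norm_norm, mul_assoc,
        inv_mul_cancel₀ this, mul_one, Real.norm_of_nonneg (by positivity)]
    · simp only [sub_self, norm_zero]
      positivity
  have hpoint : ∀ t : ℕ, 1 ≤ t → ∀ ω, ‖x (t + 1) ω - xs‖ ^ 2 ≤ ‖x t ω - xs‖ ^ 2 + (γ / t) ^ 2
      + 2 * (γ / t) * ((1 + 1 / κ) * ((if Y t ω = true then 1 else 0) * ‖x t ω - xs‖)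
        - 1 / κ * ‖x t ω - xs‖) := by
    intro t ht ω
    have hη : 0 < γ / t := by positivity
    have hX := hxX t ht ω
    have hsm := hsmooth _ hX _ hxsX
    have hst := hstrong _ hX _ hxsX
    rw [hgrad, sub_zero] at hsm hst
    by_cases h0 : h t ω = 0
    · rw [hupdate t ht ω, if_neg (not_not.2 h0)]
      by_cases hY : Y t ω = true
      · rw [if_pos hY]
        have : 2 * (γ / t) * ((1 + 1 / κ) * (1 * ‖x t ω - xs‖) - 1 / κ * ‖x t ω - xs‖)
            = 2 * (γ / t) * ‖x t ω - xs‖ := by ring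
        rw [this]
        nlinarith [mul_nonneg hη.le (norm_nonneg (x t ω - xs)), sq_nonneg (γ / t)]
      · rw [hfeed t ω, if_neg hY] at h0
        rw [h0, inner_zero_left] at hst
        have hz : ‖x t ω - xs‖ = 0 := by
          have := nonpos_of_mul_nonpos_right hst hμ
          exact pow_eq_zero_iff two_ne_zero |>.1 (le_antisymm this (sq_nonneg _))
        simp [hz, sq_nonneg]
    · rw [hupdate t ht ω, if_pos h0]
      refine (pow_le_pow_left₀ (norm_nonneg _) (hnonexp _ _ hxsX) 2).trans ?_
      rw [norm_normalized_step_sub_sq _ _ _ h0, sub_eq_add_neg, ← mul_neg]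
      gcongr
      by_cases hY : Y t ω = true
      · rw [if_pos hY]
        have hpos : 0 < ‖h t ω‖ := norm_pos_iff.2 h0
        have hcs := neg_le_of_abs_le (abs_real_inner_le_norm (h t ω) (x t ω - xs))
        have : ‖h t ω‖⁻¹ * -(‖h t ω‖ * ‖x t ω - xs‖) ≤ ‖h t ω‖⁻¹ * ⟪h t ω, x t ω - xs⟫_ℝ := by
          gcongr
        rw [mul_neg, inv_mul_cancel_left₀ hpos.ne'] at this
        linarith
      · rw [if_neg hY]
        rw [hfeed t ω, if_neg hY] at h0 ⊢
        have := norm_sub_le_mul_inner_normalized hμ h0 hsm hst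
        rw [← hκ, ← div_le_iff₀' hκ0] at this
        rw [one_div_mul_eq_div]
        linarith
  have hrm : ∀ t, Measurable fun ω => ‖x t ω - xs‖ := fun t => ((hxmeas t).sub_const xs).norm
  have hrR : ∀ t : ℕ, 1 ≤ t → ∀ ω, ‖x t ω - xs‖ ≤ R := fun t ht ω =>
    hdiam _ (hxX t ht ω) _ hxsX
  have hrint : ∀ t : ℕ, 1 ≤ t → Integrable (fun ω => ‖x t ω - xs‖) μprob := fun t ht =>
    .of_bound (hrm t).aestronglyMeasurable R (ae_of_all _ fun ω => by
      simpa using hrR t ht ω)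
  have hDint : ∀ t : ℕ, 1 ≤ t → Integrable (fun ω => ‖x t ω - xs‖ ^ 2) μprob := fun t ht =>
    .of_bound ((hrm t).pow_const 2).aestronglyMeasurable (R ^ 2) (ae_of_all _ fun ω => by
      simpa using pow_le_pow_left₀ (norm_nonneg _) (hrR t ht ω) 2)
  have hYint : ∀ t : ℕ, 1 ≤ t →
      Integrable (fun ω => (if Y t ω = true then 1 else 0) * ‖x t ω - xs‖) μprob := fun t ht =>
    .mono' (hrint t ht) (((measurable_of_finite
      (fun y : Bool => if y = true then (1 : ℝ) else 0)).comp (hYmeas t)).mul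
        (hrm t)).aestronglyMeasurable (ae_of_all _ fun ω => by split_ifs <;> simp)
  have hrec : ∀ t : ℕ, 1 ≤ t → ∫ ω, ‖x (t + 1) ω - xs‖ ^ 2 ∂μprob ≤
      ∫ ω, ‖x t ω - xs‖ ^ 2 ∂μprob - (∫ ω, ‖x t ω - xs‖ ^ 2 ∂μprob) / t
        + γ ^ 2 / (t : ℝ) ^ 2 := by
    intro t ht
    have ht0 : (0 : ℝ) < t := by exact_mod_cast ht
    have hI1 := (hDint t ht).add (integrable_const (μ := μprob) ((γ / t) ^ 2))
    have hI2 : Integrable (fun ω => (1 + 1 / κ) * ((if Y t ω = true then 1 else 0)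
        * ‖x t ω - xs‖) - 1 / κ * ‖x t ω - xs‖) μprob :=
      ((hYint t ht).const_mul (1 + 1 / κ)).sub ((hrint t ht).const_mul (1 / κ))
    have h1 := integral_mono (hDint (t + 1) (by omega))
      (hI1.add (hI2.const_mul (2 * (γ / t)))) (hpoint t ht)
    simp only [Pi.add_apply] at h1
    rw [integral_add (f := fun ω => ‖x t ω - xs‖ ^ 2 + (γ / t) ^ 2) hI1 (hI2.const_mul _),
      integral_add (hDint t ht) (integrable_const _),
      integral_const, integral_const_mul,
      integral_sub ((hYint t ht).const_mul _) ((hrint t ht).const_mul _), integral_const_mul,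
      integral_const_mul,
      integral_ite_mul_of_indepFun hp0 (hYmeas t) (hxmeas t) (hYp t) (hYindep t)
        (φ := fun y => ‖y - xs‖) (by fun_prop)] at h1
    simp only [probReal_univ, one_smul] at h1
    have h2 : ∫ ω, ‖x t ω - xs‖ ^ 2 ∂μprob ≤ R * ∫ ω, ‖x t ω - xs‖ ∂μprob := by
      rw [← integral_const_mul]
      refine integral_mono (hDint t ht) ((hrint t ht).const_mul R) fun ω => ?_
      have := mul_le_mul_of_nonneg_right (hrR t ht ω) (norm_nonneg (x t ω - xs))
      simpa only [sq] using this
    have h3 : 0 ≤ ∫ ω, ‖x t ω - xs‖ ∂μprob := integral_nonneg fun ω => norm_nonneg _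
    set D := ∫ ω, ‖x t ω - xs‖ ^ 2 ∂μprob
    set r := ∫ ω, ‖x t ω - xs‖ ∂μprob
    have h4 : 2 * (γ / t) * ((1 + 1 / κ) * (p * r) - 1 / κ * r) ≤ -(D / t) := by
      calc 2 * (γ / t) * ((1 + 1 / κ) * (p * r) - 1 / κ * r)
          ≤ 2 * (γ / t) * ((1 + 1 / κ) * (q * r) - 1 / κ * r) := by gcongr
        _ = -(2 * γ * ((1 - q) - q * κ) / κ * r / t) := by
            field_simp
            ring
        _ = -(R * r / t) := by
            rw [hγs, mul_div_cancel_left₀ _ hκ0.ne']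
        _ ≤ -(D / t) := by gcongr
    rw [div_pow] at h1
    linarith
  have hrate : ∀ k : ℕ, ∫ ω, ‖x ((k + 1) ^ 4 + 1) ω - xs‖ ^ 2 ∂μprob
      ≤ 2 * γ ^ 2 * (1 / ((k + 1 : ℕ) : ℝ) ^ 2) := by
    intro k
    have h1 := mul_le_sqrt_of_recursion
      (a := fun t => ∫ ω, ‖x t ω - xs‖ ^ 2 ∂μprob) (sq_nonneg γ) hrec ((k + 1) ^ 4)
    have h2 : √(((k + 1) ^ 4 : ℕ) : ℝ) = ((k + 1 : ℕ) : ℝ) ^ 2 := by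
      rw [Nat.cast_pow, show ((k + 1 : ℕ) : ℝ) ^ 4 = (((k + 1 : ℕ) : ℝ) ^ 2) ^ 2 by ring,
        Real.sqrt_sq (by positivity)]
    rw [h2, Nat.cast_pow, ← le_div_iff₀' (by positivity)] at h1
    refine h1.trans_eq ?_
    field_simp
  have hsummable : Summable fun k : ℕ => ∫ ω, ‖x ((k + 1) ^ 4 + 1) ω - xs‖ ^ 2 ∂μprob :=
    .of_nonneg_of_le (fun k => integral_nonneg fun ω => sq_nonneg _) hrate
      (((summable_nat_add_iff 1).2 (Real.summable_one_div_nat_pow.2 one_lt_two)).mul_left _)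
  filter_upwards [ae_tendsto_zero_of_summable_integral
    (fun k => hDint ((k + 1) ^ 4 + 1) (by omega)) (fun k ω => sq_nonneg _) hsummable] with ω hω
  refine tendsto_of_tendsto_pow_four hγ0.le (hinc ω) ?_
  rw [tendsto_iff_norm_sub_tendsto_zero, ← tendsto_add_atTop_iff_nat 1]
  simpa [Real.sqrt_sq (norm_nonneg _)] using hω.sqrt
end

section
/- Let $\mathcal{X} \subseteq \mathbb{R}^d$ be a nonempty closed convex set, let $S \subseteq \mathcal{X}$ be the nonempty closed set of minimizers of a function $f$ over $\mathcal{X}$, and for $x \in \mathcal{X}$ write $x^\star(x)$ for a point of $S$ nearest to $x$. Suppose $f$ satisfies the acute angle condition at $x \in \mathcal{X}$ with constant $\cos\phi$, i.e., $\langle g, x - x^\star(x)\rangle \ge \cos\phi\,\|g\|\|x - x^\star(x)\|$ for a subgradient $g \ne 0$. Then, for any step size $\gamma > 0$, the updated point $x^+ = \Pi_{\mathcal{X}}(x - \gamma\, g/\|g\|)$ satisfies $\|x^+ - x^\star(x^+)\|^2 \le \|x - x^\star(x)\|^2 + \gamma^2 - 2\gamma\cos\phi\,\|x - x^\star(x)\|$.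 -/
open scoped InnerProductSpace

/-- Projecting onto a convex set does not increase the distance to points of that set. -/
theorem Convex.norm_sub_le_of_isNearest {E : Type*} [NormedAddCommGroup E]
    [InnerProductSpace ℝ E] {K : Set E} (hK : Convex ℝ K) {z p y : E} (hp : p ∈ K)
    (hnear : ∀ w ∈ K, ‖p - z‖ ≤ ‖w - z‖) (hy : y ∈ K) : ‖p - y‖ ≤ ‖z - y‖ := by
  have hmin : ‖z - p‖ = ⨅ w : K, ‖z - w‖ := by
    have : Nonempty K := ⟨⟨p, hp⟩⟩
    apply le_antisymm
    · refine le_ciInf fun w => ?_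
      simpa only [norm_sub_rev] using hnear w w.2
    · exact ciInf_le (f := fun w : K => ‖z - w‖)
        ⟨0, Set.forall_mem_range.2 fun _ => norm_nonneg _⟩ ⟨p, hp⟩
  have hinner := (norm_eq_iInf_iff_real_inner_le_zero hK hp).1 hmin y hy
  have hexpand := norm_sub_sq_real (z - p) (y - p)
  rw [sub_sub_sub_cancel_right, norm_sub_rev y p] at hexpand
  refine (sq_le_sq₀ (norm_nonneg _) (norm_nonneg _)).1 ?_
  nlinarith [sq_nonneg ‖z - p‖]

/-- A normalized step of length `γ` along `-g`, where `g` makes an angle with cosine at least `c`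
with `v`. -/
theorem norm_sub_normalized_sq_le {E : Type*} [NormedAddCommGroup E] [InnerProductSpace ℝ E]
    {g v : E} (hg : g ≠ 0) {c γ : ℝ} (hγ : 0 ≤ γ) (hc : c * ‖g‖ * ‖v‖ ≤ ⟪g, v⟫_ℝ) :
    ‖v - (γ * ‖g‖⁻¹) • g‖ ^ 2 ≤ ‖v‖ ^ 2 + γ ^ 2 - 2 * γ * c * ‖v‖ := by
  have hg' : ‖g‖ ≠ 0 := norm_ne_zero_iff.2 hg
  have hnorm : ‖(γ * ‖g‖⁻¹) • g‖ = γ := by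
    rw [norm_smul, Real.norm_of_nonneg (by positivity), inv_mul_cancel_right₀ hg']
  have hstep : γ * c * ‖v‖ ≤ γ * ‖g‖⁻¹ * ⟪g, v⟫_ℝ := by
    calc γ * c * ‖v‖ = γ * ‖g‖⁻¹ * (c * ‖g‖ * ‖v‖) := by field_simp
      _ ≤ _ := by gcongr
  rw [norm_sub_sq_real, hnorm, real_inner_smul_right, real_inner_comm]
  linarith

/-- One-step bound for the normalized subgradient update with a trustworthy subgradient:
if the acute angle condition holds at `x` with constant `cos φ` for a nonzero subgradient
`g`, then the projected update `x⁺ = Π_X (x - γ g/‖g‖)` satisfies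
`‖x⁺ - x⋆(x⁺)‖² ≤ ‖x - x⋆(x)‖² + γ² - 2 γ cos φ ‖x - x⋆(x)‖`. -/
theorem nsm_one_step_trustworthy
    {d : ℕ} (X S : Set (EuclideanSpace ℝ (Fin d)))
    (hXne : X.Nonempty) (hXcl : IsClosed X) (hXconv : Convex ℝ X)
    (f : EuclideanSpace ℝ (Fin d) → ℝ)
    (hS : S = {y ∈ X | ∀ z ∈ X, f y ≤ f z}) (hSne : S.Nonempty) (hScl : IsClosed S)
    (xstar : EuclideanSpace ℝ (Fin d) → EuclideanSpace ℝ (Fin d))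
    (hxstarS : ∀ z, xstar z ∈ S)
    (hxstar_near : ∀ z, ∀ y ∈ S, ‖z - xstar z‖ ≤ ‖z - y‖)
    (proj : EuclideanSpace ℝ (Fin d) → EuclideanSpace ℝ (Fin d))
    (hprojX : ∀ z, proj z ∈ X)
    (hproj_near : ∀ z, ∀ y ∈ X, ‖proj z - z‖ ≤ ‖y - z‖)
    (x : EuclideanSpace ℝ (Fin d)) (hx : x ∈ X)
    (g : EuclideanSpace ℝ (Fin d)) (hg : g ≠ 0)
    (hgsub : ∀ y, f x + ⟪g, y - x⟫_ℝ ≤ f y)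
    (φ : ℝ)
    (hacute : Real.cos φ * ‖g‖ * ‖x - xstar x‖ ≤ ⟪g, x - xstar x⟫_ℝ)
    (γ : ℝ) (hγ : 0 < γ)
    (xp : EuclideanSpace ℝ (Fin d)) (hxp : xp = proj (x - (γ * ‖g‖⁻¹) • g)) :
    ‖xp - xstar xp‖ ^ 2 ≤
      ‖x - xstar x‖ ^ 2 + γ ^ 2 - 2 * γ * Real.cos φ * ‖x - xstar x‖ := by
  have hstarX : xstar x ∈ X := (hS ▸ hxstarS x).1
  have hproj : ‖xp - xstar x‖ ≤ ‖x - xstar x - (γ * ‖g‖⁻¹) • g‖ := by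
    rw [sub_right_comm, hxp]
    exact hXconv.norm_sub_le_of_isNearest (hprojX _) (hproj_near _) hstarX
  calc ‖xp - xstar xp‖ ^ 2 ≤ ‖x - xstar x - (γ * ‖g‖⁻¹) • g‖ ^ 2 := by
        gcongr
        exact (hxstar_near xp _ (hxstarS x)).trans hproj
    _ ≤ _ := norm_sub_normalized_sq_le hg hγ.le hacute
end

section
/- Let $d \ge 1$, let $\mathcal{D} = \{x \in \mathbb{R}^d : x_0 = x_1 = \dots = x_{d-1}\}$ be the diagonal subspace, and let $f : \mathbb{R}^d \to \mathbb{R}$ be given by $f(x) = x_{d-1}^4$. The unique minimizer of $f$ over $\mathcal{D}$ is the origin, and for every $x \in \mathcal{D}$, $\langle \nabla f(x), x - 0 \rangle = \frac{1}{\sqrt{d}}\,\|\nabla f(x)\|\,\|x - 0\|$; in particular $f$ satisfies the acute angle condition on $\mathcal{D}$ with $\cos\phi = 1/\sqrt{d}$, and with equality, so this constant is tight. -/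
open scoped InnerProductSpace

theorem EuclideanSpace.hasGradientAt_coord_pow {ι : Type*} [Fintype ι] [DecidableEq ι]
    (i : ι) (n : ℕ) (x : EuclideanSpace ℝ ι) :
    HasGradientAt (fun y : EuclideanSpace ℝ ι => y i ^ n)
      (EuclideanSpace.single i (n * x i ^ (n - 1))) x := by
  rw [hasGradientAt_iff_hasFDerivAt]
  have h : HasFDerivAt (fun y : EuclideanSpace ℝ ι => y i)
      (EuclideanSpace.proj i : EuclideanSpace ℝ ι →L[ℝ] ℝ) x :=
    (EuclideanSpace.proj i : EuclideanSpace ℝ ι →L[ℝ] ℝ).hasFDerivAt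
  refine (h.pow n).congr_fderiv ?_
  ext y
  simp [EuclideanSpace.inner_single_left]

theorem EuclideanSpace.norm_eq_sqrt_card_mul_of_forall_eq {ι : Type*} [Fintype ι]
    {x : EuclideanSpace ℝ ι} {c : ℝ} (hx : ∀ i, x i = c) :
    ‖x‖ = Real.sqrt (Fintype.card ι) * |c| := by
  simp [EuclideanSpace.norm_eq, hx, Real.sqrt_sq_eq_abs]

/-- For `f x = x_{d-1}⁴` on the diagonal subspace `D` of `ℝ^d`, the unique minimizer of
`f` over `D` is the origin and the acute angle condition holds with equality with
constant `cos φ = 1/√d`: for all `x ∈ D`,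
`⟨∇f(x), x - 0⟩ = (1/√d) ‖∇f(x)‖ ‖x - 0‖`. -/
theorem toy_example_acute_angle_tight (d : ℕ) (hd : 1 ≤ d)
    (D : Set (EuclideanSpace ℝ (Fin d)))
    (hD : D = {x | ∀ i j, x i = x j})
    (f : EuclideanSpace ℝ (Fin d) → ℝ)
    (hf : ∀ x, f x = (x ⟨d - 1, by omega⟩) ^ 4) :
    ((0 : EuclideanSpace ℝ (Fin d)) ∈ D ∧
      (∀ x ∈ D, f 0 ≤ f x) ∧
      (∀ x ∈ D, (∀ y ∈ D, f x ≤ f y) → x = 0)) ∧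
    ∀ x ∈ D,
      ⟪gradient f x, x - 0⟫_ℝ =
        (1 / Real.sqrt d) * ‖gradient f x‖ * ‖x - 0‖ := by
  subst hD
  obtain rfl : f = fun x => x ⟨d - 1, by omega⟩ ^ 4 := funext hf
  have h0 : (0 : EuclideanSpace ℝ (Fin d)) ∈
      {x : EuclideanSpace ℝ (Fin d) | ∀ i j, x i = x j} := by simp
  refine ⟨⟨h0, fun x _ => ?_, fun x hx hmin => ?_⟩, fun x hx => ?_⟩
  · have h := (by decide : Even 4).pow_nonneg (x ⟨d - 1, by omega⟩)
    simpa using h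
  · have h := hmin 0 h0
    simp only [PiLp.zero_apply] at h
    have hc : x ⟨d - 1, by omega⟩ = 0 :=
      pow_eq_zero_iff (n := 4) (by norm_num) |>.mp (le_antisymm (by simpa using h) (by positivity))
    ext i
    simpa [hc] using hx i ⟨d - 1, by omega⟩
  · have hs : Real.sqrt d ≠ 0 := by positivity
    rw [(EuclideanSpace.hasGradientAt_coord_pow _ 4 x).gradient, sub_zero,
      EuclideanSpace.norm_eq_sqrt_card_mul_of_forall_eq (x := x) fun i => hx i ⟨d - 1, by omega⟩,
      PiLp.norm_single, EuclideanSpace.inner_single_left, Fintype.card_fin]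
    generalize x ⟨d - 1, by omega⟩ = c
    have habs : |c| ^ 4 = c ^ 4 := (by decide : Even 4).pow_abs c
    simp only [conj_trivial, Real.norm_eq_abs, abs_mul, abs_pow, Nat.abs_cast]
    field_simp
    norm_num
    linear_combination -habs
end
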